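/- arXiv:math-ph/0607063 — 2 statements merged into one kernel-verified Lean document; each statement's English description precedes it below -/
import Mathlib

section
/- Assume (E): Λ : ℤ^d → A is a colouring and (Q_j)_{j∈ℕ} a van Hove sequence such that for every box pattern P at the origin the frequency ν_P of P in Λ along (Q_j) exists. Let X be a Banach space and F : 𝓕 → X be Λ-invariant, almost-additive with boundary term b, and bounded with constant C. Then the limit F̄ := lim_{j→∞} F(Q_j)/|Q_j| exists in X. -/
open Filter
noncomputable section

/-- `ℤ^d`. -/
abbrev Zd (d : ℕ) := Fin d → ℤ

namespace IDSZd

variable {d : ℕ} {A : Type*} {X : Type*}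

/-- The ℓ∞ (maximum) distance on `ℤ^d`, as a natural number. -/
def dInf (x y : Zd d) : ℕ := Finset.univ.sup fun j => (x j - y j).natAbs

/-- The closed ℓ∞-ball of radius `S` around `q`, as a finset. -/
def ball (q : Zd d) (S : ℕ) : Finset (Zd d) :=
  Fintype.piFinset fun j => Finset.Icc (q j - S) (q j + S)

open Classical in
/-- The `S`-boundary `∂^S Q` of a finite set `Q ⊆ ℤ^d`:  points outside `Q` within
distance `S` of `Q` together with points of `Q` within distance `S` of the complement. -/
def sBdry (S : ℕ) (Q : Finset (Zd d)) : Finset (Zd d) :=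
  ((Q.biUnion fun q => ball q S).filter fun x => x ∉ Q) ∪
    (Q.filter fun x => ∃ y : Zd d, y ∉ Q ∧ dInf x y ≤ S)

/-- A van Hove sequence of (nonempty) finite subsets of `ℤ^d`. -/
def VanHove (Q : ℕ → Finset (Zd d)) : Prop :=
  (∀ j, (Q j).Nonempty) ∧
    ∀ S : ℕ, Tendsto (fun j => ((sBdry S (Q j)).card : ℝ) / ((Q j).card : ℝ)) atTop (nhds 0)

/-- The translate `t + Q` of a finite set `Q ⊆ ℤ^d`. -/
def shift (t : Zd d) (Q : Finset (Zd d)) : Finset (Zd d) := Q.image (t + ·)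

/-- The box `C_M = {0, …, M−1}^d`. -/
def cube (d M : ℕ) : Finset (Zd d) := Fintype.piFinset fun _ => Finset.Ico (0 : ℤ) (M : ℤ)

/-- A box `[a₁,b₁] × ⋯ × [a_d,b_d]` in `ℤ^d`. -/
def IsBox (Q : Finset (Zd d)) : Prop :=
  ∃ a b : Zd d, (∀ j, a j ≤ b j) ∧ Q = Fintype.piFinset fun j => Finset.Icc (a j) (b j)

/-- A box at the origin, i.e. `[0,b₁] × ⋯ × [0,b_d]`. -/
def IsBoxAtOrigin (Q : Finset (Zd d)) : Prop :=
  ∃ b : Zd d, (∀ j, 0 ≤ b j) ∧ Q = Fintype.piFinset fun j => Finset.Icc 0 (b j)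

open Classical in
/-- The number of occurrences `♯_P P'` of the pattern `P` with domain `B` (given by a
total function) in the pattern `P'` with domain `Q` given by the total function `L`. -/
def occ (B : Finset (Zd d)) (P : Zd d → A) (Q : Finset (Zd d)) (L : Zd d → A) : ℕ :=
  (Q.filter fun x => shift x B ⊆ Q ∧ ∀ y ∈ B, L (x + y) = P y).card

/-- Extension of a pattern `P` with domain `B` to a total function on `ℤ^d`
(by a junk value taken from the colouring `Λ`). -/
def extPat (Λ : Zd d → A) (B : Finset (Zd d)) (P : ↥B → A) : Zd d → A :=
  fun y => if h : y ∈ B then P ⟨y, h⟩ else Λ 0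

/-- `ν` is the frequency function of the colouring `Λ` along the sequence `Q`:
for every box pattern at the origin the frequency exists and is given by `ν`. -/
def Freqs (Λ : Zd d → A) (Q : ℕ → Finset (Zd d)) (ν : Finset (Zd d) → (Zd d → A) → ℝ) : Prop :=
  ∀ B : Finset (Zd d), IsBoxAtOrigin B → ∀ P : Zd d → A,
    Tendsto (fun j => (occ B P (Q j) Λ : ℝ) / ((Q j).card : ℝ)) atTop (nhds (ν B P))

/-- A boundary term with constant `D`. -/
def IsBoundaryTerm (b : Finset (Zd d) → ℝ) (D : ℝ) : Prop :=
  (∀ Q, 0 ≤ b Q) ∧ (∀ t Q, b (shift t Q) = b Q) ∧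
    (∀ Q : ℕ → Finset (Zd d), VanHove Q →
      Tendsto (fun j => b (Q j) / ((Q j).card : ℝ)) atTop (nhds 0)) ∧
    0 < D ∧ ∀ Q : Finset (Zd d), b Q ≤ D * Q.card

section NormedX
variable [NormedAddCommGroup X]

/-- Almost additivity of `F` with boundary term `b`. -/
def AlmostAdditive (F : Finset (Zd d) → X) (b : Finset (Zd d) → ℝ) : Prop :=
  ∀ (m : ℕ) (Qs : Fin m → Finset (Zd d)), (∀ k l, k ≠ l → Disjoint (Qs k) (Qs l)) →
    ‖F (Finset.univ.biUnion Qs) - ∑ k, F (Qs k)‖ ≤ ∑ k, b (Qs k)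

/-- `Λ`-invariance of `F`. -/
def Invariant (Λ : Zd d → A) (F : Finset (Zd d) → X) : Prop :=
  ∀ (t : Zd d) (Q : Finset (Zd d)), (∀ y ∈ Q, Λ (t + y) = Λ y) → F (shift t Q) = F Q

/-- `Ft` is the map on box patterns at the origin (given by domain and total function,
depending only on the restriction of the function to the domain) induced by the
`Λ`-invariant map `F`. -/
def IsInducedMap (Λ : Zd d → A) (F : Finset (Zd d) → X)
    (Ft : Finset (Zd d) → (Zd d → A) → X) : Prop :=
  (∀ (B : Finset (Zd d)) (P P' : Zd d → A), (∀ y ∈ B, P y = P' y) → Ft B P = Ft B P') ∧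
    ∀ (t : Zd d) (Q : Finset (Zd d)), IsBoxAtOrigin Q →
      F (shift t Q) = Ft Q fun y => Λ (t + y)

/-- Boundedness of `F` with constant `C`. -/
def Bounded (F : Finset (Zd d) → X) (C : ℝ) : Prop := ∀ Q : Finset (Zd d), ‖F Q‖ ≤ C * Q.card

/-- The pattern average `Σ_{P ∈ 𝓟_M} ν_P F̃(P) / |C_M|`. -/
def patAvg [NormedSpace ℝ X] [Fintype A] (Λ : Zd d → A)
    (ν : Finset (Zd d) → (Zd d → A) → ℝ) (Ft : Finset (Zd d) → (Zd d → A) → X) (M : ℕ) : X :=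
  (((cube d M).card : ℝ))⁻¹ • ∑ P : ↥(cube d M) → A,
    ν (cube d M) (extPat Λ (cube d M) P) • Ft (cube d M) (extPat Λ (cube d M) P)

end NormedX

/-- The set of shifts `a` with `C_M(a) ∩ Q ≠ ∅`. -/
def coverShifts (Q : Finset (Zd d)) (M : ℕ) : Finset (Zd d) :=
  Q.biUnion fun q => Fintype.piFinset fun j => Finset.Ioc (q j - M) (q j)

/-- The set `D_{Q,x,M}` of lattice shifts `a ∈ x + (Mℤ)^d` whose box `C_M(a)` meets `Q`
but is not contained in `Q`. -/
def latticeD (Q : Finset (Zd d)) (x : Zd d) (M : ℕ) : Finset (Zd d) :=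
  (coverShifts Q M).filter fun a => (∀ j, (M : ℤ) ∣ (a j - x j)) ∧ ¬ shift a (cube d M) ⊆ Q

/-- The set `I_{Q,x,M}` of lattice shifts `a ∈ x + (Mℤ)^d` with `C_M(a) ⊆ Q` (for `M ≥ 1`). -/
def latticeI (Q : Finset (Zd d)) (x : Zd d) (M : ℕ) : Finset (Zd d) :=
  (coverShifts Q M).filter fun a => (∀ j, (M : ℤ) ∣ (a j - x j)) ∧ shift a (cube d M) ⊆ Q


/-! ### Auxiliary results -/

theorem mem_cube {M : ℕ} {x : Zd d} : x ∈ cube d M ↔ ∀ j, 0 ≤ x j ∧ x j < M := by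
  simp [cube]

theorem mem_shift {t y : Zd d} {Q : Finset (Zd d)} : y ∈ shift t Q ↔ y - t ∈ Q := by
  simp only [shift, Finset.mem_image]
  constructor
  · rintro ⟨a, ha, rfl⟩
    simpa using ha
  · intro h
    exact ⟨y - t, h, by abel⟩

theorem card_shift (t : Zd d) (Q : Finset (Zd d)) : (shift t Q).card = Q.card :=
  Finset.card_image_of_injective _ (add_right_injective t)

theorem card_cube (M : ℕ) : (cube d M).card = M ^ d := by
  simp [cube]

theorem dInf_le {x y : Zd d} {S : ℕ} : dInf x y ≤ S ↔ ∀ j, (x j - y j).natAbs ≤ S := by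
  simp [dInf]

theorem sBdry_cube_subset (S M : ℕ) :
    sBdry S (cube d M) ⊆
      (Fintype.piFinset fun _ => Finset.Ico (-(S : ℤ)) ((M : ℤ) + S)) \
        (Fintype.piFinset fun _ => Finset.Ico (S : ℤ) ((M : ℤ) - S)) := by
  intro x hx
  simp only [sBdry, Finset.mem_union, Finset.mem_filter, Finset.mem_biUnion, ball,
    Fintype.mem_piFinset, Finset.mem_Icc, mem_cube, dInf_le] at hx
  simp only [Finset.mem_sdiff, Fintype.mem_piFinset, Finset.mem_Ico]
  rcases hx with ⟨⟨q, hq, hxq⟩, hx⟩ | ⟨hx, y, hy, hxy⟩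
  · refine ⟨fun j => ?_, fun h => hx fun j => ?_⟩
    · have := hq j; have := hxq j; omega
    · have := h j; omega
  · refine ⟨fun j => ?_, fun h => hy fun j => ?_⟩
    · have := hx j; omega
    · have := h j; have := hxy j; omega

theorem vanHove_cube : VanHove (fun M : ℕ => cube d (M + 1)) := by
  refine ⟨fun M => ⟨0, by rw [mem_cube]; intro j; simp⟩, fun S => ?_⟩
  have hlim : Tendsto (fun M : ℕ => (1 + 2 * (S : ℝ) * (1 / ((M : ℝ) + 1))) ^ d
      - (1 - 2 * (S : ℝ) * (1 / ((M : ℝ) + 1))) ^ d) atTop (nhds 0) := by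
    have h0 := (tendsto_one_div_add_atTop_nhds_zero_nat (𝕜 := ℝ)).const_mul (2 * (S : ℝ))
    have h1 := (((h0.const_add 1).pow d).sub ((h0.const_sub 1).pow d))
    simpa using h1
  refine squeeze_zero' (Eventually.of_forall fun M => by positivity) ?_ hlim
  filter_upwards [eventually_ge_atTop (2 * S)] with M hM
  have hsub : (Fintype.piFinset fun _ : Fin d => Finset.Ico (S : ℤ) (((M + 1 : ℕ) : ℤ) - S)) ⊆
      (Fintype.piFinset fun _ : Fin d => Finset.Ico (-(S : ℤ)) (((M + 1 : ℕ) : ℤ) + S)) := by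
    intro x hx
    simp only [Fintype.mem_piFinset, Finset.mem_Ico] at hx ⊢
    intro j
    have := hx j
    omega
  have hc := Finset.card_le_card (sBdry_cube_subset (d := d) S (M + 1))
  rw [Finset.card_sdiff_of_subset hsub] at hc
  have e1 : (((M + 1 : ℕ) : ℤ) + S - (-(S : ℤ))).toNat = M + 1 + 2 * S := by omega
  have e2 : (((M + 1 : ℕ) : ℤ) - S - (S : ℤ)).toNat = M + 1 - 2 * S := by omega
  simp only [Fintype.card_piFinset, Int.card_Ico, Finset.prod_const, Finset.card_univ,
    Fintype.card_fin, e1, e2] at hc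
  have hle : (M + 1 - 2 * S) ^ d ≤ (M + 1 + 2 * S) ^ d := Nat.pow_le_pow_left (by omega) d
  have hc' : ((sBdry S (cube d (M + 1))).card : ℝ) ≤
      ((M : ℝ) + 1 + 2 * S) ^ d - ((M : ℝ) + 1 - 2 * S) ^ d := by
    have h3 : ((sBdry S (cube d (M + 1))).card : ℝ) ≤
      (((M + 1 + 2 * S) ^ d - (M + 1 - 2 * S) ^ d : ℕ) : ℝ) := by exact_mod_cast hc
    rw [Nat.cast_sub hle] at h3
    have h4 : 2 * S ≤ M + 1 := by omega
    push_cast [Nat.cast_sub h4] at h3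
    exact h3
  have hM0 : (0 : ℝ) < (M : ℝ) + 1 := by positivity
  rw [card_cube]
  push_cast
  rw [div_le_iff₀ (by positivity), sub_mul, ← mul_pow, ← mul_pow]
  have e3 : (1 + 2 * (S : ℝ) * (1 / ((M : ℝ) + 1))) * ((M : ℝ) + 1) = (M : ℝ) + 1 + 2 * S := by
    field_simp
  have e4 : (1 - 2 * (S : ℝ) * (1 / ((M : ℝ) + 1))) * ((M : ℝ) + 1) = (M : ℝ) + 1 - 2 * S := by
    field_simp
  rw [e3, e4]
  exact hc'

section AA
variable [NormedAddCommGroup X]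

theorem AlmostAdditive.fintype {F : Finset (Zd d) → X} {b : Finset (Zd d) → ℝ}
    (h : AlmostAdditive F b) {ι : Type*} [Fintype ι] (t : ι → Finset (Zd d))
    (ht : ∀ k l, k ≠ l → Disjoint (t k) (t l)) :
    ‖F (Finset.univ.biUnion t) - ∑ k, F (t k)‖ ≤ ∑ k, b (t k) := by
  have e := (Fintype.equivFin ι).symm
  have := h (Fintype.card ι) (fun i => t (e i)) (fun k l hkl => ht _ _ (e.injective.ne hkl))
  rw [e.sum_comp (fun i => F (t i)), e.sum_comp (fun i => b (t i))] at this
  convert this using 4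
  ext x
  simp only [Finset.mem_biUnion, Finset.mem_univ, true_and]
  constructor
  · rintro ⟨a, ha⟩
    exact ⟨e.symm a, by simpa using ha⟩
  · rintro ⟨a, ha⟩
    exact ⟨_, ha⟩

open Classical in
/-- Positions of the cubes of side `M` contained in `Q`. -/
def inner (Q : Finset (Zd d)) (M : ℕ) : Finset (Zd d) :=
  Q.filter fun a => shift a (cube d M) ⊆ Q

/-- Residue vector modulo `M`. -/
def resid (M : ℕ) (a : Zd d) : Zd d := fun j => a j % (M : ℤ)

open Classical in
/-- Tiling estimate for one residue class. -/
theorem tile_estimate {F : Finset (Zd d) → X} {b : Finset (Zd d) → ℝ} {D C : ℝ}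
    (hb : IsBoundaryTerm b D) (hAA : AlmostAdditive F b) (hC : 0 < C) (hBd : Bounded F C)
    {M : ℕ} (hM : 0 < M) (Q : Finset (Zd d)) (x : Zd d) (hx : resid M x = x) :
    ‖F Q - ∑ a ∈ (inner Q M).filter (fun a => resid M a = x), F (shift a (cube d M))‖ ≤
      b (cube d M) / (cube d M).card * Q.card + (C + D) * (sBdry M Q).card := by
  obtain ⟨hb0, hbt, -, hD, hbD⟩ := hb
  set I := (inner Q M).filter (fun a => resid M a = x) with hI
  set U := I.biUnion (fun a => shift a (cube d M)) with hU
  set R := Q \ U with hR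
  have hMz : (0 : ℤ) < M := by exact_mod_cast hM
  have hUQ : U ⊆ Q := by
    intro y hy
    obtain ⟨a, ha, hya⟩ := Finset.mem_biUnion.1 hy
    exact (Finset.mem_filter.1 (Finset.mem_filter.1 ha).1).2 hya
  have hdisj : ∀ a ∈ I, ∀ a' ∈ I, a ≠ a' →
      Disjoint (shift a (cube d M)) (shift a' (cube d M)) := by
    intro a ha a' ha' hne
    rw [Finset.disjoint_left]
    intro y hy hy'
    apply hne
    have h1 : resid M a = resid M a' :=
      (Finset.mem_filter.1 ha).2.trans (Finset.mem_filter.1 ha').2.symm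
    rw [mem_shift, mem_cube] at hy hy'
    funext j
    have h2 := congrFun h1 j
    simp only [resid] at h2
    have h3 := hy j
    have h4 := hy' j
    simp only [Pi.sub_apply] at h3 h4
    have h5 : (M : ℤ) ∣ a j - a' j := (Int.ModEq.dvd (Int.ModEq.symm h2))
    have h6 : a j - a' j = 0 := by
      apply Int.eq_zero_of_abs_lt_dvd h5
      rw [abs_lt]; omega
    omega
  let t : Option I → Finset (Zd d) := fun o => o.elim R (fun a => shift a.1 (cube d M))
  have hRd : ∀ a ∈ I, Disjoint R (shift a (cube d M)) := by
    intro a ha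
    rw [Finset.disjoint_left]
    intro y hy hya
    exact (Finset.mem_sdiff.1 hy).2 (Finset.mem_biUnion.2 ⟨a, ha, hya⟩)
  have ht : ∀ k l, k ≠ l → Disjoint (t k) (t l) := by
    rintro (_ | k) (_ | l) hkl
    · exact absurd rfl hkl
    · exact hRd l.1 l.2
    · exact (hRd k.1 k.2).symm
    · refine hdisj k.1 k.2 l.1 l.2 fun h => hkl ?_
      rw [Subtype.ext h]
  have hUn : Finset.univ.biUnion t = Q := by
    ext y
    simp only [Finset.mem_biUnion, Finset.mem_univ, true_and]
    constructor
    · rintro ⟨_ | k, hk⟩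
      · exact (Finset.mem_sdiff.1 hk).1
      · exact hUQ (Finset.mem_biUnion.2 ⟨k.1, k.2, hk⟩)
    · intro hy
      by_cases hyU : y ∈ U
      · obtain ⟨a, ha, hya⟩ := Finset.mem_biUnion.1 hyU
        exact ⟨some ⟨a, ha⟩, hya⟩
      · exact ⟨none, Finset.mem_sdiff.2 ⟨hy, hyU⟩⟩
  have hmain := hAA.fintype t ht
  rw [hUn, Fintype.sum_option, Fintype.sum_option] at hmain
  simp only [t, Option.elim_none, Option.elim_some, hbt] at hmain
  rw [Finset.sum_coe_sort I (fun a => F (shift a (cube d M)))] at hmain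
  simp only [Finset.sum_const, Finset.card_univ, Fintype.card_coe, nsmul_eq_mul] at hmain
  have hcard : (I.card : ℝ) * (cube d M).card ≤ Q.card := by
    have h1 : U.card = I.card * (cube d M).card := by
      rw [hU, Finset.card_biUnion hdisj]
      simp [card_shift]
    exact_mod_cast h1 ▸ Finset.card_le_card hUQ
  have hcpos : (0 : ℝ) < (cube d M).card := by
    rw [card_cube]; positivity
  have hIb : (I.card : ℝ) * b (cube d M) ≤ b (cube d M) / (cube d M).card * Q.card := by
    rw [div_mul_eq_mul_div, le_div_iff₀ hcpos]
    nlinarith [hb0 (cube d M)]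
  have hRs : R ⊆ sBdry M Q := by
    intro q hq
    obtain ⟨hqQ, hqU⟩ := Finset.mem_sdiff.1 hq
    let a : Zd d := fun j => q j - (q j - x j) % (M : ℤ)
    have hqa : q ∈ shift a (cube d M) := by
      rw [mem_shift, mem_cube]
      intro j
      have h1 := Int.emod_nonneg (q j - x j) hMz.ne'
      have h2 := Int.emod_lt_of_pos (q j - x j) hMz
      simp only [a, Pi.sub_apply]
      omega
    have haa : ∀ y ∈ shift a (cube d M), ∀ j, a j ≤ y j ∧ y j < a j + M := by
      intro y hy j
      rw [mem_shift, mem_cube] at hy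
      have := hy j
      simp only [Pi.sub_apply] at this
      omega
    have hnot : ¬ shift a (cube d M) ⊆ Q := by
      intro hs
      apply hqU
      refine Finset.mem_biUnion.2 ⟨a, ?_, hqa⟩
      refine Finset.mem_filter.2 ⟨Finset.mem_filter.2 ⟨hs ?_, hs⟩, ?_⟩
      · rw [mem_shift, mem_cube]
        intro j
        simp [hM]
      · rw [← hx]
        funext j
        simp only [resid, a]
        rw [Int.sub_emod, Int.emod_emod, ← Int.sub_emod]
        congr 1
        ring
    obtain ⟨y, hy, hyQ⟩ := Finset.not_subset.1 hnot
    refine Finset.mem_union_right _ (Finset.mem_filter.2 ⟨hqQ, y, hyQ, ?_⟩)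
    rw [dInf_le]
    intro j
    have := haa y hy j
    have := haa q hqa j
    omega
  have hRc : (R.card : ℝ) ≤ (sBdry M Q).card := by exact_mod_cast Finset.card_le_card hRs
  have h1 := hBd R
  have h2 := hbD R
  calc _ = ‖(F Q - (F R + ∑ a ∈ I, F (shift a (cube d M)))) + F R‖ := by congr 1; abel
    _ ≤ _ := norm_add_le _ _
    _ ≤ (b R + I.card * b (cube d M)) + C * R.card := add_le_add hmain h1
    _ ≤ _ := by nlinarith

end AA

section Main
variable [NormedAddCommGroup X] [NormedSpace ℝ X]

/-- Averaged tiling estimate. -/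
theorem avg_estimate {F : Finset (Zd d) → X} {b : Finset (Zd d) → ℝ} {D C : ℝ}
    (hb : IsBoundaryTerm b D) (hAA : AlmostAdditive F b) (hC : 0 < C) (hBd : Bounded F C)
    {M : ℕ} (hM : 0 < M) (Q : Finset (Zd d)) (hQ : Q.Nonempty) :
    ‖((Q.card : ℝ))⁻¹ • F Q - ((cube d M).card : ℝ)⁻¹ •
        ((Q.card : ℝ)⁻¹ • ∑ a ∈ inner Q M, F (shift a (cube d M)))‖ ≤
      b (cube d M) / (cube d M).card + (C + D) * ((sBdry M Q).card / Q.card) := by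
  classical
  have hMz : (0 : ℤ) < M := by exact_mod_cast hM
  have hmaps : ∀ a ∈ inner Q M, resid M a ∈ cube d M := by
    intro a _
    rw [mem_cube]
    intro j
    exact ⟨Int.emod_nonneg _ hMz.ne', Int.emod_lt_of_pos _ hMz⟩
  have hsum := Finset.sum_fiberwise_of_maps_to hmaps (fun a => F (shift a (cube d M)))
  have hcpos : (0 : ℝ) < (cube d M).card := by
    rw [card_cube]; positivity
  have hQpos : (0 : ℝ) < Q.card := by exact_mod_cast hQ.card_pos
  set K := b (cube d M) / (cube d M).card * Q.card + (C + D) * (sBdry M Q).card with hK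
  have h1 : ‖((cube d M).card : ℝ) • F Q - ∑ a ∈ inner Q M, F (shift a (cube d M))‖ ≤
      (cube d M).card * K := by
    rw [← hsum, Nat.cast_smul_eq_nsmul, ← Finset.sum_const, ← Finset.sum_sub_distrib,
      ← nsmul_eq_mul]
    refine (norm_sum_le _ _).trans ?_
    apply Finset.sum_le_card_nsmul
    intro x hx
    have hx' : resid M x = x := by
      rw [mem_cube] at hx
      funext j
      exact Int.emod_eq_of_lt (hx j).1 (hx j).2
    convert tile_estimate hb hAA hC hBd hM Q x hx'
  have h2 : ((Q.card : ℝ))⁻¹ • F Q - ((cube d M).card : ℝ)⁻¹ •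
        ((Q.card : ℝ)⁻¹ • ∑ a ∈ inner Q M, F (shift a (cube d M))) =
      (((cube d M).card : ℝ)⁻¹ * (Q.card : ℝ)⁻¹) • (((cube d M).card : ℝ) • F Q -
        ∑ a ∈ inner Q M, F (shift a (cube d M))) := by
    rw [smul_sub, smul_smul, smul_smul]
    congr 2
    field_simp
  rw [h2, norm_smul, Real.norm_of_nonneg (by positivity)]
  refine (mul_le_mul_of_nonneg_left h1 (by positivity)).trans (le_of_eq ?_)
  rw [hK]
  field_simp

/-- Convergence of the averages of `F` over all cubes of side `M`. -/
theorem cube_avg_tendsto [Fintype A] {Λ : Zd d → A} {Qs : ℕ → Finset (Zd d)}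
    {ν : Finset (Zd d) → (Zd d → A) → ℝ} (hν : Freqs Λ Qs ν)
    {F : Finset (Zd d) → X} (hInv : Invariant Λ F) {M : ℕ} (hM : 0 < M) :
    ∃ L : X, Tendsto (fun j => ((Qs j).card : ℝ)⁻¹ •
      ∑ a ∈ inner (Qs j) M, F (shift a (cube d M))) atTop (nhds L) := by
  classical
  let pat : Zd d → (↥(cube d M) → A) := fun a y => Λ (a + y.1)
  have hpat : ∀ a a', pat a = pat a' → F (shift a (cube d M)) = F (shift a' (cube d M)) := by
    intro a a' h
    have h1 := hInv (a - a') (shift a' (cube d M)) (by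
      intro y hy
      rw [mem_shift] at hy
      have h2 := congrFun h ⟨y - a', hy⟩
      simp only [pat] at h2
      rw [show a - a' + y = a + (y - a') by abel, h2]
      congr 1; abel)
    rw [← h1]
    congr 1
    ext y
    simp only [mem_shift]
    rw [show y - (a - a') - a' = y - a by abel]
  let v : (↥(cube d M) → A) → X := fun P =>
    if h : ∃ a, pat a = P then F (shift h.choose (cube d M)) else 0
  have hv : ∀ a, F (shift a (cube d M)) = v (pat a) := by
    intro a
    have h : ∃ a', pat a' = pat a := ⟨a, rfl⟩
    simp only [v, dif_pos h]
    exact hpat _ _ h.choose_spec.symm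
  have hbox : IsBoxAtOrigin (cube d M) := by
    refine ⟨fun _ => (M : ℤ) - 1, fun j => by dsimp only; omega, ?_⟩
    ext x
    simp only [mem_cube, Fintype.mem_piFinset, Finset.mem_Icc]
    exact forall_congr' fun j => by omega
  have hG : ∀ Q : Finset (Zd d), ∑ a ∈ inner Q M, F (shift a (cube d M)) =
      ∑ P : ↥(cube d M) → A,
        (occ (cube d M) (extPat Λ (cube d M) P) Q Λ : ℝ) • v P := by
    intro Q
    rw [← Finset.sum_fiberwise (inner Q M) pat]
    refine Finset.sum_congr rfl fun P _ => ?_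
    have : ∀ a ∈ (inner Q M).filter (fun a => pat a = P), F (shift a (cube d M)) = v P := by
      intro a ha
      rw [hv, (Finset.mem_filter.1 ha).2]
    rw [Finset.sum_congr rfl this, Finset.sum_const, Nat.cast_smul_eq_nsmul]
    congr 1
    unfold occ inner
    rw [Finset.filter_filter]
    congr 1
    ext a
    simp only [Finset.mem_filter]
    refine and_congr_right fun _ => and_congr_right fun _ => ?_
    constructor
    · rintro rfl y hy
      simp [extPat, hy, pat]
    · intro h
      funext y
      have := h y.1 y.2
      simpa [extPat, pat] using this
  refine ⟨∑ P : ↥(cube d M) → A, ν (cube d M) (extPat Λ (cube d M) P) • v P, ?_⟩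
  have : (fun j => ((Qs j).card : ℝ)⁻¹ • ∑ a ∈ inner (Qs j) M, F (shift a (cube d M))) =
      fun j => ∑ P : ↥(cube d M) → A,
        ((occ (cube d M) (extPat Λ (cube d M) P) (Qs j) Λ : ℝ) / ((Qs j).card : ℝ)) • v P := by
    funext j
    rw [hG, Finset.smul_sum]
    refine Finset.sum_congr rfl fun P _ => ?_
    rw [smul_smul, div_eq_inv_mul]
  rw [this]
  exact tendsto_finsetSum _ fun P _ => (hν _ hbox _).smul_const _

end Main

/-- **Theorem (ergodic theorem, existence of the limit):** under assumption (E)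
(frequencies of all box patterns at the origin exist along the van Hove sequence `Qs`),
for a `Λ`-invariant, almost-additive, bounded function `F` with values in a Banach space,
the limit `F̄ = lim_j F(Q_j)/|Q_j|` exists. -/
theorem ergodic_limit_exists {X : Type*} [NormedAddCommGroup X] [NormedSpace ℝ X]
    [CompleteSpace X] [Fintype A]
    (hd : 1 ≤ d) (Λ : Zd d → A) (Qs : ℕ → Finset (Zd d)) (hvH : VanHove Qs)
    (ν : Finset (Zd d) → (Zd d → A) → ℝ) (hν : Freqs Λ Qs ν)
    (F : Finset (Zd d) → X) (b : Finset (Zd d) → ℝ) (D : ℝ) (hb : IsBoundaryTerm b D)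
    (hInv : Invariant Λ F) (hAA : AlmostAdditive F b)
    (C : ℝ) (hCpos : 0 < C) (hBd : Bounded F C) :
    ∃ Fbar : X, Filter.Tendsto (fun j => (((Qs j).card : ℝ))⁻¹ • F (Qs j))
      Filter.atTop (nhds Fbar) := by
  obtain ⟨-, -, hbV, hD, -⟩ := id hb
  have key : ∀ ε > 0, ∃ L : X, ∀ᶠ j in atTop, ‖((Qs j).card : ℝ)⁻¹ • F (Qs j) - L‖ < ε := by
    intro ε hε
    obtain ⟨M, hM⟩ := ((hbV _ vanHove_cube).eventually (gt_mem_nhds (by positivity : 0 < ε / 3))).exists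
    obtain ⟨L, hL⟩ := cube_avg_tendsto hν hInv (M := M + 1) (by omega)
    have hL' := hL.const_smul (((cube d (M + 1)).card : ℝ)⁻¹)
    refine ⟨((cube d (M + 1)).card : ℝ)⁻¹ • L, ?_⟩
    have hS := (hvH.2 (M + 1)).const_mul (C + D)
    rw [mul_zero] at hS
    filter_upwards [hS.eventually (gt_mem_nhds (by positivity : 0 < ε / 3)),
      hL'.eventually (Metric.ball_mem_nhds _ (by positivity : 0 < ε / 3))] with j h1 h2
    have h3 := avg_estimate hb hAA hCpos hBd (M := M + 1) (by omega) (Qs j) (hvH.1 j)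
    rw [dist_eq_norm] at h2
    have h4 := norm_sub_le_norm_sub_add_norm_sub (((Qs j).card : ℝ)⁻¹ • F (Qs j))
      (((cube d (M + 1)).card : ℝ)⁻¹ • (((Qs j).card : ℝ)⁻¹ •
        ∑ a ∈ inner (Qs j) (M + 1), F (shift a (cube d (M + 1)))))
      (((cube d (M + 1)).card : ℝ)⁻¹ • L)
    linarith
  apply cauchySeq_tendsto_of_complete
  rw [Metric.cauchySeq_iff']
  intro ε hε
  obtain ⟨L, hL⟩ := key (ε / 2) (by positivity)
  obtain ⟨N, hN⟩ := eventually_atTop.1 hL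
  refine ⟨N, fun n hn => ?_⟩
  have h1 := hN n hn
  have h2 := hN N le_rfl
  rw [← dist_eq_norm] at h1 h2
  have := dist_triangle_right (((Qs n).card : ℝ)⁻¹ • F (Qs n)) (((Qs N).card : ℝ)⁻¹ • F (Qs N)) L
  linarith

end IDSZd
end
end

section
/- Let M ∈ ℕ with M ≥ 1, Q ∈ 𝓕 and x ∈ ℤ^d. With ℤ_{x,M} := x + (Mℤ)^d and D_{Q,x,M} := {a ∈ ℤ_{x,M} : C_M(a) ∩ Q ≠ ∅ and C_M(a) ⊄ Q}, one has the bound |D_{Q,x,M}| · |C_M| ≤ |∂^M Q| (equivalently |D_{Q,x,M}| ≤ |∂^M Q|/M^d). -/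
open Filter
noncomputable section

namespace IDSZd

variable {d : ℕ} {A : Type*} {X : Type*}

/-- **Proposition (boundary boxes estimate):** for a finite set `Q ⊆ ℤ^d`, `x ∈ ℤ^d` and
`M ≥ 1`, the number of boxes `C_M(a)`, `a ∈ x + (Mℤ)^d`, which meet `Q` but are not
contained in `Q` satisfies `|D_{Q,x,M}| ⬝ |C_M| ≤ |∂^M Q|`. -/
theorem latticeD_card_le (hd : 1 ≤ d) (Q : Finset (Zd d)) (x : Zd d) (M : ℕ) (hM : 1 ≤ M) :
    (latticeD Q x M).card * (cube d M).card ≤ (sBdry M Q).card := by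
  rw [← Finset.card_product]
  apply Finset.card_le_card_of_injOn (fun p : Zd d × Zd d => p.1 + p.2)
  · rintro ⟨a, c⟩ hp
    simp only [Finset.coe_product, Set.mem_prod, Finset.mem_coe] at hp
    obtain ⟨ha, hc⟩ := hp
    simp only [latticeD, coverShifts, Finset.mem_filter, Finset.mem_biUnion,
      Fintype.mem_piFinset, Finset.mem_Ioc] at ha
    obtain ⟨⟨q, hq, hqa⟩, -, hn⟩ := ha
    rw [Finset.not_subset] at hn
    obtain ⟨y, hy, hyQ⟩ := hn
    simp only [shift, Finset.mem_image] at hy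
    obtain ⟨e, he, rfl⟩ := hy
    simp only [cube, Fintype.mem_piFinset, Finset.mem_Ico] at hc he
    simp only [Finset.mem_coe, sBdry, Finset.mem_union, Finset.mem_filter, Finset.mem_biUnion]
    by_cases h : a + c ∈ Q
    · right
      refine ⟨h, a + e, hyQ, ?_⟩
      unfold dInf
      apply Finset.sup_le
      intro j _
      have h1 := hc j
      have h2 := he j
      simp only [Pi.add_apply]
      omega
    · left
      refine ⟨⟨q, hq, ?_⟩, h⟩
      simp only [ball, Fintype.mem_piFinset, Finset.mem_Icc, Pi.add_apply]
      intro j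
      have h1 := hc j
      have h2 := hqa j
      omega
  · rintro ⟨a, c⟩ hp ⟨b, e⟩ hq h
    simp only [Finset.coe_product, Set.mem_prod, Finset.mem_coe, latticeD, Finset.mem_filter] at hp hq h
    obtain ⟨⟨-, hda, -⟩, hc⟩ := hp
    obtain ⟨⟨-, hdb, -⟩, he⟩ := hq
    simp only [cube, Fintype.mem_piFinset, Finset.mem_Ico] at hc he
    have key : ∀ j, c j = e j := by
      intro j
      have h0 : a j + c j = b j + e j := congrFun h j
      have hdvd : (M : ℤ) ∣ c j - e j := by
        have h3 := dvd_sub (hdb j) (hda j)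
        have h4 : b j - x j - (a j - x j) = c j - e j := by linarith
        rwa [h4] at h3
      have h1 := hc j
      have h2 := he j
      have h5 : c j - e j = 0 := by
        apply Int.eq_zero_of_abs_lt_dvd hdvd
        rw [abs_lt]
        constructor <;> linarith
      linarith
    have hce : c = e := funext key
    subst hce
    have hab : a = b := add_right_cancel h
    rw [hab]

end IDSZd
end
end
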